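/- arXiv:1511.04516 — 4 statements merged into one kernel-verified Lean document; each statement's English description precedes it below -/
import Mathlib

section
/- Let M̂ be an n×n complex Hermitian matrix, D = diag(Δ₁, …, Δ_n) with Δ_i ∈ ℝ, and Ñ = diag(√κ̃₁, …, √κ̃_n) with κ̃_i > 0. Define X = 2i·Ñ^{-†}(M̂ − D)Ñ^{-1}. Then: (i) X is skew-Hermitian; (ii) X + I is invertible, R := (X − I)(X + I)^{-1} is unitary, I − R is invertible, and (I − R)^{-1}(I + R) = X; (iii) D − (i/2)·Ñ†XÑ = M̂; and consequently, for any m×n complex matrix N̂, the closed-loop drift matrix of the feedback network, −i·D − (1/2)·Ñ†Ñ − (1/2)·N̂†N̂ − Ñ†·(I − R)^{-1}R·Ñ, equals the drift matrix −i·M̂ − (1/2)·N̂†N̂ of the reduced system with Hamiltonian matrix M̂. -/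
open Matrix

/-- Feedback realization of the Hamiltonian of the reduced passive system:
with `D = diag(Δᵢ)`, `Nt = Ñ = diag(√κ̃ᵢ)` and `X = 2i·Ñ^{-†}(M̂ - D)Ñ⁻¹`,
the matrix `X` is skew-Hermitian, the Cayley transform `R = (X-I)(X+I)⁻¹` is a
well-defined unitary feedback gain with `I - R` invertible and
`(I-R)⁻¹(I+R) = X`, the Hamiltonian `D - (i/2)Ñ†XÑ` equals `M̂ = Mh`, and the
closed-loop drift matrix equals the drift matrix of the reduced system. -/
theorem feedback_hamiltonian_passive (n m : ℕ)
    (Mh D Nt X : Matrix (Fin n) (Fin n) ℂ)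
    (hM : Mh.IsHermitian)
    (Δ : Fin n → ℝ) (κ : Fin n → ℝ) (hκ : ∀ i, 0 < κ i)
    (hD : D = Matrix.diagonal fun i => (Δ i : ℂ))
    (hNt : Nt = Matrix.diagonal fun i => (Real.sqrt (κ i) : ℂ))
    (hX : X = (2 * Complex.I) • ((Ntᴴ)⁻¹ * (Mh - D) * Nt⁻¹)) :
    -- (i) `X` is skew-Hermitian
    Xᴴ = -X ∧
    -- (ii) `X + I` is invertible, `R` is unitary, `I - R` is invertible,
    -- and `(I - R)⁻¹ (I + R) = X`
    IsUnit (X + 1) ∧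
    (X - 1) * (X + 1)⁻¹ ∈ Matrix.unitaryGroup (Fin n) ℂ ∧
    IsUnit ((1 : Matrix (Fin n) (Fin n) ℂ) - (X - 1) * (X + 1)⁻¹) ∧
    (1 - (X - 1) * (X + 1)⁻¹)⁻¹ * (1 + (X - 1) * (X + 1)⁻¹) = X ∧
    -- (iii) the realized Hamiltonian is `M̂`
    D - (Complex.I / 2) • (Ntᴴ * X * Nt) = Mh ∧
    -- consequently the closed-loop drift matrix equals the reduced drift matrix
    (∀ Nh : Matrix (Fin m) (Fin n) ℂ,
      (-Complex.I) • D - (1 / 2 : ℂ) • (Ntᴴ * Nt) - (1 / 2 : ℂ) • (Nhᴴ * Nh)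
          - Ntᴴ * ((1 - (X - 1) * (X + 1)⁻¹)⁻¹ * ((X - 1) * (X + 1)⁻¹)) * Nt
        = (-Complex.I) • Mh - (1 / 2 : ℂ) • (Nhᴴ * Nh)) := by
  have hNH : Ntᴴ = Nt := by
    subst hNt
    rw [Matrix.diagonal_conjTranspose]
    congr 1
    funext i
    simp
  have hDH : Dᴴ = D := by
    subst hD
    rw [Matrix.diagonal_conjTranspose]
    congr 1
    funext i
    simp
  have hNu : IsUnit Nt.det := by
    rw [hNt, Matrix.det_diagonal, isUnit_iff_ne_zero]
    refine Finset.prod_ne_zero_iff.mpr fun i _ => ?_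
    exact_mod_cast (Real.sqrt_pos.mpr (hκ i)).ne'
  have h1 : Xᴴ = -X := by
    have hMH : Mhᴴ = Mh := hM
    rw [hX, Matrix.conjTranspose_smul, Matrix.conjTranspose_mul, Matrix.conjTranspose_mul,
      Matrix.conjTranspose_nonsing_inv, Matrix.conjTranspose_nonsing_inv, hNH, hNH,
      Matrix.conjTranspose_sub, hMH, hDH, ← neg_smul, Matrix.mul_assoc]
    congr 1
    simp
  have hpd : IsUnit ((X + 1)ᴴ * (X + 1)) := by
    have e : (X + 1)ᴴ * (X + 1) = 1 + Xᴴ * X := by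
      rw [Matrix.conjTranspose_add, Matrix.conjTranspose_one, h1]
      noncomm_ring
    rw [e]
    open scoped ComplexOrder in
    exact (Matrix.PosDef.one.add_posSemidef (Matrix.posSemidef_conjTranspose_mul_self X)).isUnit
  have hdet : IsUnit (X + 1).det := by
    have h := (Matrix.isUnit_iff_isUnit_det _).mp hpd
    rw [Matrix.det_mul] at h
    exact isUnit_of_mul_isUnit_right h
  have hU : IsUnit (X + 1) := (Matrix.isUnit_iff_isUnit_det _).mpr hdet
  have hYr : (X + 1) * (X + 1)⁻¹ = 1 := Matrix.mul_nonsing_inv _ hdet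
  have hYl : (X + 1)⁻¹ * (X + 1) = 1 := Matrix.nonsing_inv_mul _ hdet
  generalize (X + 1)⁻¹ = Y at hYr hYl ⊢
  have hsub : (1 : Matrix (Fin n) (Fin n) ℂ) - (X - 1) * Y = (2 : ℂ) • Y := by
    rw [two_smul]
    nth_rewrite 1 [← hYr]
    noncomm_ring
  have hadd : (1 : Matrix (Fin n) (Fin n) ℂ) + (X - 1) * Y = (2 : ℂ) • (X * Y) := by
    rw [two_smul]
    nth_rewrite 1 [← hYr]
    noncomm_ring
  have hprod : ((2 : ℂ)⁻¹ • (X + 1)) * ((2 : ℂ) • Y) = 1 := by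
    rw [Matrix.smul_mul, Matrix.mul_smul, smul_smul, hYr]
    norm_num
  have hprod2 : ((2 : ℂ) • Y) * ((2 : ℂ)⁻¹ • (X + 1)) = 1 := mul_eq_one_comm.mp hprod
  have hinv : ((2 : ℂ) • Y)⁻¹ = (2 : ℂ)⁻¹ • (X + 1) := Matrix.inv_eq_left_inv hprod
  have hXY : (X + 1) * (X * Y) = X := by
    have : (X + 1) * (X * Y) = X * ((X + 1) * Y) := by noncomm_ring
    rw [this, hYr, mul_one]
  have hXY2 : (X + 1) * ((X - 1) * Y) = X - 1 := by
    have : (X + 1) * ((X - 1) * Y) = (X - 1) * ((X + 1) * Y) := by noncomm_ring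
    rw [this, hYr, mul_one]
  have h3 : D - (Complex.I / 2) • (Ntᴴ * X * Nt) = Mh := by
    have e : Ntᴴ * X * Nt = (2 * Complex.I) • (Mh - D) := by
      rw [hX, hNH, Matrix.mul_smul, Matrix.smul_mul]
      congr 1
      have : Nt * (Nt⁻¹ * (Mh - D) * Nt⁻¹) * Nt
          = (Nt * Nt⁻¹) * (Mh - D) * (Nt⁻¹ * Nt) := by simp only [Matrix.mul_assoc]
      rw [this, Matrix.mul_nonsing_inv _ hNu, Matrix.nonsing_inv_mul _ hNu, one_mul, mul_one]
    have c : Complex.I / 2 * (2 * Complex.I) = -1 := by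
      linear_combination Complex.I_mul_I
    rw [e, smul_smul, c, neg_one_smul]
    abel
  refine ⟨h1, hU, ?_, ?_, ?_, h3, ?_⟩
  · rw [Matrix.mem_unitaryGroup_iff', Matrix.star_eq_conjTranspose, Matrix.conjTranspose_mul,
      Matrix.conjTranspose_sub, Matrix.conjTranspose_one, h1]
    have e : Yᴴ * (-X - 1) * ((X - 1) * Y) = Yᴴ * (-X + 1) * ((X + 1) * Y) := by noncomm_ring
    have e2 := congrArg Matrix.conjTranspose hYr
    rw [Matrix.conjTranspose_mul, Matrix.conjTranspose_add, Matrix.conjTranspose_one, h1] at e2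
    rw [e, hYr, mul_one, e2]
  · rw [hsub]
    exact IsUnit.of_mul_eq_one _ hprod2
  · rw [hsub, hadd, hinv, Matrix.smul_mul, Matrix.mul_smul, smul_smul, hXY]
    norm_num
  · intro Nh
    rw [hsub, hinv, Matrix.smul_mul, hXY2, ← h3, Matrix.mul_smul,
      Matrix.smul_mul, mul_sub, sub_mul, mul_one, smul_sub (-Complex.I), smul_smul]
    have c : -Complex.I * (Complex.I / 2) = 1 / 2 := by
      linear_combination (-1 / 2 : ℂ) * Complex.I_mul_I
    rw [c]
    module
end

section
/- Let 𝒩 be a 2n×2n complex matrix that is ♭-Hermitian, i.e., 𝒩^♭ = 𝒩. Then there exist an invertible 2n×2n complex matrix Z, positive integers k₁, …, k_B with k₁ + ⋯ + k_B = 2n, signs ε₁, …, ε_A ∈ {+1, −1}, real numbers λ₁, …, λ_A and non-real complex numbers λ_{A+1}, …, λ_B (with k_i even for i > A), such that Z^{-1}𝒩Z = diag(𝐣_{k₁}(λ₁), …, 𝐣_{k_A}(λ_A), 𝐣_{k_{A+1}}(λ_{A+1}), …, 𝐣_{k_B}(λ_B)) and Z†J_{2n}Z = diag(ε₁𝒮_{k₁},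 …, ε_A𝒮_{k_A}, 𝒮_{k_{A+1}}, …, 𝒮_{k_B}). -/
open Matrix

noncomputable section

/-- The Krein-space metric `J_{2k} = diag(I_k, -I_k)`. -/
def Jmat (k : ℕ) : Matrix (Fin k ⊕ Fin k) (Fin k ⊕ Fin k) ℂ :=
  Matrix.fromBlocks 1 0 0 (-1)

/-- The block-swap matrix `Σ_{2k} = [[0, I_k],[I_k, 0]]`. -/
def Sig (k : ℕ) : Matrix (Fin k ⊕ Fin k) (Fin k ⊕ Fin k) ℂ :=
  Matrix.fromBlocks 0 1 1 0

/-- A `2r × 2s` complex matrix is doubled-up if `Σ_{2r} X Σ_{2s} = X^#`. -/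
def DoubledUp {r s : ℕ} (X : Matrix (Fin r ⊕ Fin r) (Fin s ⊕ Fin s) ℂ) : Prop :=
  Sig r * X * Sig s = X.map (starRingEnd ℂ)

/-- The ♭-adjoint `X^♭ = J_{2s} X† J_{2r}` of a `2r × 2s` complex matrix. -/
def flatAdj {r s : ℕ} (X : Matrix (Fin r ⊕ Fin r) (Fin s ⊕ Fin s) ℂ) :
    Matrix (Fin s ⊕ Fin s) (Fin r ⊕ Fin r) ℂ :=
  Jmat s * Xᴴ * Jmat r

/-- A `2k × 2k` complex matrix is Bogoliubov if it is doubled-up and ♭-unitary. -/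
def Bogoliubov {k : ℕ} (R : Matrix (Fin k ⊕ Fin k) (Fin k ⊕ Fin k) ℂ) : Prop :=
  DoubledUp R ∧ R * flatAdj R = 1 ∧ flatAdj R * R = 1

/-- The "sip" matrix: ones on the antidiagonal. -/
def sipC (k : ℕ) : Matrix (Fin k) (Fin k) ℂ :=
  Matrix.of fun i j => if (i : ℕ) + (j : ℕ) + 1 = k then 1 else 0

/-- `𝐣_k(λ)`: for real `λ`, the `k × k` upper Jordan block with eigenvalue `λ`;
for non-real `λ` (and even `k`), the direct sum of two `(k/2) × (k/2)` upper
Jordan blocks with eigenvalues `λ` and `λ*`. -/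
def jordanLike (k : ℕ) (lam : ℂ) : Matrix (Fin k) (Fin k) ℂ :=
  if lam.im = 0 then
    Matrix.of fun i j =>
      if (j : ℕ) = (i : ℕ) then lam
      else if (j : ℕ) = (i : ℕ) + 1 then 1 else 0
  else
    Matrix.of fun i j =>
      if (j : ℕ) = (i : ℕ) then (if (i : ℕ) < k / 2 then lam else starRingEnd ℂ lam)
      else if (j : ℕ) = (i : ℕ) + 1 ∧ (i : ℕ) + 1 ≠ k / 2 then 1 else 0

section KreinAux

variable {V : Type} [AddCommGroup V] [Module ℂ V]

/-- A family of vectors realizing one canonical block. -/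
def KBlock (H : V →ₗ⋆[ℂ] V →ₗ[ℂ] ℂ) (N : Module.End ℂ V) (K : ℕ) (lam ε : ℂ)
    (b : Fin K → V) : Prop :=
  0 < K ∧ ((lam.im = 0 ∧ (ε = 1 ∨ ε = -1)) ∨ (lam.im ≠ 0 ∧ Even K ∧ ε = 1)) ∧
  (∀ j, N (b j) = ∑ l, jordanLike K lam l j • b l) ∧
  (∀ i j, H (b i) (b j) = ε * sipC K i j)

lemma adj_pow (H : V →ₗ⋆[ℂ] V →ₗ[ℂ] ℂ) (N : Module.End ℂ V)
    (hN : ∀ x y, H (N x) y = H x (N y)) (μ ν : ℂ) (hμ : starRingEnd ℂ μ = ν) (m : ℕ) (x y : V) :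
    H (((N - μ • (1 : Module.End ℂ V)) ^ m) x) y
      = H x (((N - ν • (1 : Module.End ℂ V)) ^ m) y) := by
  induction m generalizing x y with
  | zero => simp
  | succ m ih =>
    rw [pow_succ, Module.End.mul_apply, ih, pow_succ', Module.End.mul_apply]
    simp [hN, hμ]

lemma orth_gen (H : V →ₗ⋆[ℂ] V →ₗ[ℂ] ℂ) (N : Module.End ℂ V)
    (hN : ∀ x y, H (N x) y = H x (N y)) (lam μ : ℂ) (h : starRingEnd ℂ μ ≠ lam) (x y : V)
    (hx : x ∈ N.maxGenEigenspace lam) (hy : y ∈ N.maxGenEigenspace μ) : H y x = 0 := by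
  rw [Module.End.mem_maxGenEigenspace] at hx hy
  obtain ⟨m, hx⟩ := hx
  obtain ⟨l, hy⟩ := hy
  have hc : IsCoprime ((Polynomial.X - Polynomial.C lam) ^ m)
      ((Polynomial.X - Polynomial.C (starRingEnd ℂ μ)) ^ l) :=
    (Polynomial.isCoprime_X_sub_C_of_isUnit_sub
      (IsUnit.mk0 _ (sub_ne_zero.2 h.symm))).pow
  obtain ⟨p, q, hpq⟩ := hc
  have key := congrArg (fun r => Polynomial.aeval N r x) hpq
  have e1 : ∀ c : ℂ, Polynomial.aeval N (Polynomial.X - Polynomial.C c)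
      = N - c • (1 : Module.End ℂ V) := by
    intro c
    simp [Algebra.algebraMap_eq_smul_one]
  rw [mul_comm q] at hpq
  have key := congrArg (fun r => Polynomial.aeval N r x) hpq
  simp only [map_add, map_mul, map_pow, e1, map_one, LinearMap.add_apply, Module.End.mul_apply,
    hx, map_zero, zero_add, Module.End.one_apply] at key
  rw [← key, ← adj_pow H N hN μ _ rfl, hy]
  simp

lemma nondeg_gen [FiniteDimensional ℂ V] (H : V →ₗ⋆[ℂ] V →ₗ[ℂ] ℂ) (N : Module.End ℂ V)
    (hN : ∀ x y, H (N x) y = H x (N y)) (hnd : ∀ y, (∀ x, H y x = 0) → y = 0)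
    (lam μ : ℂ) (h : starRingEnd ℂ μ = lam) (y : V) (hy : y ∈ N.maxGenEigenspace μ)
    (h0 : ∀ x ∈ N.maxGenEigenspace lam, H y x = 0) : y = 0 := by
  apply hnd
  have : (⊤ : Submodule ℂ V) ≤ LinearMap.ker (H y) := by
    rw [← Module.End.iSup_maxGenEigenspace_eq_top N]
    refine iSup_le fun ν x hx => ?_
    rw [LinearMap.mem_ker]
    by_cases hν : starRingEnd ℂ μ = ν
    · exact h0 x (by rw [← h, hν]; exact hx)
    · exact orth_gen H N hN ν μ hν x y hx hy
  intro x
  exact this (Submodule.mem_top (x := x))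

/-- Basic pair of vectors of maximal height. -/
lemma exists_top_pair [FiniteDimensional ℂ V] [Nontrivial V]
    (H : V →ₗ⋆[ℂ] V →ₗ[ℂ] ℂ) (hH : ∀ x y, H y x = starRingEnd ℂ (H x y)) (N : Module.End ℂ V)
    (hN : ∀ x y, H (N x) y = H x (N y)) (hnd : ∀ y, (∀ x, H y x = 0) → y = 0) :
    ∃ (lam : ℂ) (K : ℕ) (x y : V),
      x ∈ N.maxGenEigenspace lam ∧ y ∈ N.maxGenEigenspace (starRingEnd ℂ lam) ∧
      (∀ z ∈ N.maxGenEigenspace lam, ((N - lam • (1 : Module.End ℂ V)) ^ (K + 1)) z = 0) ∧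
      ((N - (starRingEnd ℂ lam) • (1 : Module.End ℂ V)) ^ (K + 1)) y = 0 ∧
      H y (((N - lam • (1 : Module.End ℂ V)) ^ K) x) ≠ 0 := by
  classical
  obtain ⟨lam, hlam⟩ := Module.End.exists_eigenvalue N
  obtain ⟨v, hv⟩ := hlam.exists_hasEigenvector
  have hv0 : v ≠ 0 := hv.2
  have hvm : v ∈ N.maxGenEigenspace lam := by
    rw [Module.End.mem_maxGenEigenspace]
    refine ⟨1, ?_⟩
    have := hv.apply_eq_smul
    simp [this]
  have hex : ∃ k : ℕ, ∀ z ∈ N.maxGenEigenspace lam,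
      ((N - lam • (1 : Module.End ℂ V)) ^ k) z = 0 := by
    refine ⟨Module.finrank ℂ V, fun z hz => ?_⟩
    rw [Module.End.maxGenEigenspace_eq_genEigenspace_finrank] at hz
    simpa [Module.End.mem_genEigenspace_nat] using hz
  have hspec := Nat.find_spec hex
  have hmin := fun m => Nat.find_min hex (m := m)
  cases hK : Nat.find hex with
  | zero =>
    rw [hK] at hspec
    exact absurd (by simpa using hspec v hvm) hv0
  | succ K =>
    rw [hK] at hspec
    have h1 := hmin K (by omega)
    push Not at h1
    obtain ⟨x, hx, hx0⟩ := h1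
    have hx' : ((N - lam • (1 : Module.End ℂ V)) ^ K) x ∈ N.maxGenEigenspace lam := by
      rw [Module.End.mem_maxGenEigenspace]
      refine ⟨1, ?_⟩
      rw [← Module.End.mul_apply, ← pow_add, add_comm]
      exact hspec x hx
    have h2 : ∃ y ∈ N.maxGenEigenspace (starRingEnd ℂ lam),
        H y (((N - lam • (1 : Module.End ℂ V)) ^ K) x) ≠ 0 := by
      by_contra hcon
      push Not at hcon
      apply hx0
      refine nondeg_gen H N hN hnd (starRingEnd ℂ lam) lam rfl _ hx' fun z hz => ?_
      rw [hH z, hcon z hz, map_zero]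
    obtain ⟨y, hy, hy0⟩ := h2
    refine ⟨lam, K, x, y, hx, hy, hspec, ?_, hy0⟩
    refine nondeg_gen H N hN hnd lam (starRingEnd ℂ lam) (by simp) _ ?_ fun z hz => ?_
    · rw [Module.End.mem_maxGenEigenspace] at hy ⊢
      obtain ⟨m, hm⟩ := hy
      refine ⟨m, ?_⟩
      rw [← Module.End.mul_apply, ← pow_add, add_comm, pow_add, Module.End.mul_apply, hm, map_zero]
    · rw [adj_pow H N hN _ lam (by simp), hspec z hz, map_zero]

lemma pow_apply_zero (M : Module.End ℂ V) (K m : ℕ) (x : V) (hx : (M ^ K) x = 0) (h : K ≤ m) :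
    (M ^ m) x = 0 := by
  obtain ⟨c, rfl⟩ := Nat.exists_eq_add_of_le h
  rw [add_comm, pow_add, Module.End.mul_apply, hx, map_zero]

lemma pow_comp_apply (M : Module.End ℂ V) (a b : ℕ) (x : V) :
    (M ^ a) ((M ^ b) x) = (M ^ (a + b)) x := by
  rw [pow_add, Module.End.mul_apply]

lemma sum_helper (k j : ℕ) (hj : j < k) (P : ℕ → Prop) [DecidablePred P] (c : ℕ → ℂ) (f : ℕ → V) :
    ∑ l : Fin k, (if j = (l : ℕ) then c l else if j = (l : ℕ) + 1 ∧ P l then 1 else 0) • f l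
      = c j • f j + if j = 0 then 0 else if P (j - 1) then f (j - 1) else 0 := by
  rw [Fin.sum_univ_eq_sum_range
    (fun l => (if j = l then c l else if j = l + 1 ∧ P l then (1 : ℂ) else 0) • f l)]
  have : ∀ l, (if j = l then c l else if j = l + 1 ∧ P l then (1 : ℂ) else 0) • f l
      = (if j = l then c l • f l else 0) + (if j = l + 1 ∧ P l then f l else 0) := by
    intro l
    by_cases h1 : j = l
    · subst h1; simp
    · by_cases h2 : j = l + 1 ∧ P l <;> simp [h1, h2]
  simp_rw [this, Finset.sum_add_distrib, Finset.sum_ite_eq, Finset.mem_range, if_pos hj]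
  congr 1
  cases j with
  | zero => simp
  | succ j =>
    rw [Finset.sum_eq_single j]
    · simp
    · intro l _ hl
      rw [if_neg]
      omega
    · intro h
      exact absurd (Finset.mem_range.2 (by omega)) h

/-- Normalizing a chain with real eigenvalue. -/
lemma normalize_real (H : V →ₗ⋆[ℂ] V →ₗ[ℂ] ℂ) (hH : ∀ x y, H y x = starRingEnd ℂ (H x y))
    (M : Module.End ℂ V) (hM : ∀ m x y, H ((M ^ m) x) y = H x ((M ^ m) y)) (K : ℕ) (x : V)
    (hx : (M ^ (K + 1)) x = 0) (h0 : H x ((M ^ K) x) ≠ 0) :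
    ∃ (ε : ℂ) (x' : V), (ε = 1 ∨ ε = -1) ∧ (M ^ (K + 1)) x' = 0 ∧
      H x' ((M ^ K) x') = ε ∧ ∀ j < K, H x' ((M ^ j) x') = 0 := by
  have hreal : ∀ (x : V) (j : ℕ), (((H x ((M ^ j) x)).re : ℝ) : ℂ) = H x ((M ^ j) x) := by
    intro x j
    apply Complex.conj_eq_iff_re.1
    rw [← hH, hM]
  -- scaling
  obtain ⟨ε, x1, hε, hx1, hx1e⟩ : ∃ (ε : ℂ) (x' : V), (ε = 1 ∨ ε = -1) ∧ (M ^ (K + 1)) x' = 0 ∧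
      H x' ((M ^ K) x') = ε := by
    set r := (H x ((M ^ K) x)).re with hr
    have hr' := hreal x K
    rw [← hr] at hr'
    have hr0 : r ≠ 0 := by
      intro h; apply h0; rw [← hr', h]; simp
    have habs : 0 < |r| := abs_pos.2 hr0
    have hs : (Real.sqrt |r|) * (Real.sqrt |r|) = |r| := Real.mul_self_sqrt habs.le
    have hs0 : Real.sqrt |r| ≠ 0 := (Real.sqrt_pos.2 habs).ne'
    refine ⟨((r / |r| : ℝ) : ℂ), (((Real.sqrt |r|)⁻¹ : ℝ) : ℂ) • x, ?_, ?_, ?_⟩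
    · rcases lt_or_gt_of_ne hr0 with h | h
      · right; rw [abs_of_neg h, div_neg, div_self hr0]; simp
      · left; rw [abs_of_pos h, div_self hr0]; simp
    · simp [hx]
    · simp only [map_smul, LinearMap.map_smulₛₗ, LinearMap.smul_apply, smul_eq_mul,
        Complex.conj_ofReal, ← hr']
      have hs' : ((|r| : ℝ) : ℂ) = (Real.sqrt |r| : ℂ) * (Real.sqrt |r| : ℂ) := by
        rw [← Complex.ofReal_mul, hs]
      have hs0' : (Real.sqrt |r| : ℂ) ≠ 0 := by exact_mod_cast hs0
      rw [Complex.ofReal_div, hs', Complex.ofReal_inv]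
      field_simp
  -- correction
  have hε0 : ε ≠ 0 := by rcases hε with h | h <;> simp [h]
  have key : ∀ s ≤ K, ∃ x' : V, (M ^ (K + 1)) x' = 0 ∧ H x' ((M ^ K) x') = ε ∧
      ∀ j < K, K ≤ j + s → H x' ((M ^ j) x') = 0 := by
    intro s
    induction s with
    | zero => intro _; exact ⟨x1, hx1, hx1e, fun j h1 h2 => absurd h2 (by omega)⟩
    | succ s ih =>
      intro hs
      obtain ⟨x, hx, hxe, hxj⟩ := ih (by omega)
      obtain ⟨m, hm⟩ := Nat.exists_eq_add_of_le hs
      set a : ℂ := - H x ((M ^ m) x) / (2 * ε) with ha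
      have hεc : starRingEnd ℂ ε = ε := by rcases hε with h | h <;> simp [h]
      have hac : starRingEnd ℂ a = a := by
        have h2 : starRingEnd ℂ (2 : ℂ) = 2 := map_ofNat _ 2
        have h3 : starRingEnd ℂ (H x ((M ^ m) x)) = H x ((M ^ m) x) := by rw [← hH, hM]
        simp only [ha, map_div₀, map_neg, map_mul, hεc, h2, h3]
      have hexp : ∀ j, H (x + a • (M ^ (s + 1)) x) ((M ^ j) (x + a • (M ^ (s + 1)) x))
          = H x ((M ^ j) x) + 2 * a * H x ((M ^ (j + (s + 1))) x)
            + a * a * H x ((M ^ (j + (s + 1) + (s + 1))) x) := by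
        intro j
        have e1 : (M ^ j) ((M ^ (s + 1)) x) = (M ^ (j + (s + 1))) x := by
          rw [pow_comp_apply]
        have e2 : (M ^ (s + 1)) ((M ^ j) x) = (M ^ (j + (s + 1))) x := by
          rw [pow_comp_apply, add_comm]
        have e3 : (M ^ (s + 1)) ((M ^ (j + (s + 1))) x) = (M ^ (j + (s + 1) + (s + 1))) x := by
          rw [pow_comp_apply, add_comm]
        simp only [map_add, map_smul, LinearMap.map_smulₛₗ, LinearMap.smul_apply,
          LinearMap.add_apply, smul_eq_mul, hac, hM, e1, e2, e3]
        ring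
      have hz : ∀ j, K < j → (M ^ j) x = 0 := fun j hj => pow_apply_zero M _ j x hx hj
      refine ⟨x + a • (M ^ (s + 1)) x, ?_, ?_, ?_⟩
      · rw [map_add, hx, map_smul, ← Module.End.mul_apply, ← pow_add, hz _ (by omega)]
        simp
      · rw [hexp, hz (K + (s + 1)) (by omega), hz (K + (s + 1) + (s + 1)) (by omega), hxe]
        simp
      · intro j hj hjs
        rw [hexp, hz (j + (s + 1) + (s + 1)) (by omega)]
        by_cases hjm : j = m
        · subst hjm
          have : j + (s + 1) = K := by omega
          rw [this, hxe, ha]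
          field_simp
          simp
        · rw [hxj j hj (by omega), hz (j + (s + 1)) (by omega)]
          simp
  obtain ⟨x', h1, h2, h3⟩ := key K le_rfl
  exact ⟨ε, x', hε, h1, h2, fun j hj => h3 j hj (by omega)⟩

/-- Normalizing a pair of chains. -/
lemma normalize_pair (φ : V →ₗ[ℂ] ℂ)
    (M : Module.End ℂ V) (U : Submodule ℂ V) (hU : ∀ m, ∀ z ∈ U, (M ^ m) z ∈ U) (K : ℕ) (x : V)
    (hxU : x ∈ U)
    (hx : (M ^ (K + 1)) x = 0) (h0 : φ ((M ^ K) x) ≠ 0) :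
    ∃ (x' : V), x' ∈ U ∧ (M ^ (K + 1)) x' = 0 ∧
      φ ((M ^ K) x') = 1 ∧ ∀ j < K, φ ((M ^ j) x') = 0 := by
  have key : ∀ s ≤ K, ∃ x' : V, x' ∈ U ∧ (M ^ (K + 1)) x' = 0 ∧ φ ((M ^ K) x') = 1 ∧
      ∀ j < K, K ≤ j + s → φ ((M ^ j) x') = 0 := by
    intro s
    induction s with
    | zero =>
      intro _
      refine ⟨(φ ((M ^ K) x))⁻¹ • x, U.smul_mem _ hxU, by simp [hx], ?_,
        fun j h1 h2 => absurd h2 (by omega)⟩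
      simp [h0]
    | succ s ih =>
      intro hs
      obtain ⟨x, hxU, hx, hxe, hxj⟩ := ih (by omega)
      obtain ⟨m, hm⟩ := Nat.exists_eq_add_of_le hs
      set a : ℂ := - φ ((M ^ m) x) with ha
      have hexp : ∀ j, φ ((M ^ j) (x + a • (M ^ (s + 1)) x))
          = φ ((M ^ j) x) + a * φ ((M ^ (j + (s + 1))) x) := by
        intro j
        have e1 : (M ^ j) ((M ^ (s + 1)) x) = (M ^ (j + (s + 1))) x := by
          rw [pow_comp_apply]
        simp only [map_add, map_smul, smul_eq_mul, e1]
      have hz : ∀ j, K < j → (M ^ j) x = 0 := fun j hj => pow_apply_zero M _ j x hx hj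
      refine ⟨x + a • (M ^ (s + 1)) x, U.add_mem hxU (U.smul_mem _ (hU _ _ hxU)), ?_, ?_, ?_⟩
      · rw [map_add, hx, map_smul, ← Module.End.mul_apply, ← pow_add, hz _ (by omega)]
        simp
      · rw [hexp, hz (K + (s + 1)) (by omega), hxe]
        simp
      · intro j hj hjs
        rw [hexp]
        by_cases hjm : j = m
        · subst hjm
          have : j + (s + 1) = K := by omega
          rw [this, hxe, ha]
          simp
        · rw [hxj j hj (by omega), hz (j + (s + 1)) (by omega)]
          simp
  obtain ⟨x', h0, h1, h2, h3⟩ := key K le_rfl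
  exact ⟨x', h0, h1, h2, fun j hj => h3 j hj (by omega)⟩

lemma exists_block [FiniteDimensional ℂ V] [Nontrivial V]
    (H : V →ₗ⋆[ℂ] V →ₗ[ℂ] ℂ) (hH : ∀ x y, H y x = starRingEnd ℂ (H x y)) (N : Module.End ℂ V)
    (hN : ∀ x y, H (N x) y = H x (N y)) (hnd : ∀ y, (∀ x, H y x = 0) → y = 0) :
    ∃ (K : ℕ) (lam ε : ℂ) (b : Fin K → V), KBlock H N K lam ε b := by
  obtain ⟨lam, K, x, y, hx, hy, hall, hyK, hne⟩ := exists_top_pair H hH N hN hnd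
  have hNM : ∀ (c : ℂ) (v : V), N v = c • v + ((N - c • (1 : Module.End ℂ V)) ^ 1) v := by
    intro c v; simp
  by_cases hlam : lam.im = 0
  · have hc : starRingEnd ℂ lam = lam := Complex.conj_eq_iff_im.2 hlam
    rw [hc] at hy
    set M := N - lam • (1 : Module.End ℂ V) with hMdef
    have hM : ∀ m x y, H ((M ^ m) x) y = H x ((M ^ m) y) :=
      fun m x y => adj_pow H N hN lam lam hc m x y
    have hex : ∃ z ∈ N.maxGenEigenspace lam, H z ((M ^ K) z) ≠ 0 := by
      by_contra hcon
      push Not at hcon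
      have h1 := hcon x hx
      have h2 := hcon y hy
      have h3 := hcon (y + x) (Submodule.add_mem _ hy hx)
      have h4 := hcon (y + Complex.I • x) (Submodule.add_mem _ hy (Submodule.smul_mem _ _ hx))
      simp only [map_add, map_smul, LinearMap.map_smulₛₗ, LinearMap.smul_apply,
        LinearMap.add_apply, smul_eq_mul, h1, h2, Complex.conj_I] at h3 h4
      apply hne
      have h5 : H x ((M ^ K) y) = - H y ((M ^ K) x) := by linear_combination h3
      rw [h5] at h4
      have h6 : Complex.I * (2 * H y ((M ^ K) x)) = 0 := by linear_combination h4
      simpa using h6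
    obtain ⟨z, hz, hz0⟩ := hex
    obtain ⟨ε, w, hε, hw, hwe, hwj⟩ := normalize_real H hH M hM K z (hall z hz) hz0
    refine ⟨K + 1, lam, ε, fun j => (M ^ (K - (j : ℕ))) w, Nat.succ_pos _, Or.inl ⟨hlam, hε⟩,
      ?_, ?_⟩
    · intro j
      have hs := sum_helper (K + 1) j j.2 (fun _ => True) (fun _ => lam) (fun l => (M ^ (K - l)) w)
      simp only [and_true] at hs
      simp only [jordanLike, if_pos hlam, Matrix.of_apply]
      rw [hs, hNM lam, pow_comp_apply]
      congr 1
      have := j.2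
      split_ifs with h0
      · exact pow_apply_zero M (K + 1) _ w hw (by omega)
      · congr 2; omega
    · intro i j
      have h1 := i.2
      have h2 := j.2
      simp only [sipC, Matrix.of_apply]
      rw [hM, pow_comp_apply]
      split_ifs with h0
      · rw [show K - (i : ℕ) + (K - (j : ℕ)) = K by omega, hwe, mul_one]
      · rw [mul_zero]
        by_cases h3 : K - (i : ℕ) + (K - (j : ℕ)) < K
        · exact hwj _ h3
        · rw [pow_apply_zero M (K + 1) _ w hw (by omega), map_zero]
  · set M := N - lam • (1 : Module.End ℂ V) with hMdef
    set M' := N - (starRingEnd ℂ lam) • (1 : Module.End ℂ V) with hMdef'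
    have hU : ∀ (μ : ℂ) (m : ℕ), ∀ z ∈ N.maxGenEigenspace μ,
        ((N - μ • (1 : Module.End ℂ V)) ^ m) z ∈ N.maxGenEigenspace μ := by
      intro μ m z hz
      rw [Module.End.mem_maxGenEigenspace] at hz ⊢
      obtain ⟨l, hl⟩ := hz
      refine ⟨l, ?_⟩
      rw [pow_comp_apply, add_comm, ← pow_comp_apply, hl, map_zero]
    obtain ⟨w, hwU, hw, hwe, hwj⟩ :=
      normalize_pair (H y) M (N.maxGenEigenspace lam) (hU lam) K x hx (hall x hx) hne
    have hlc : starRingEnd ℂ lam ≠ lam := fun h => hlam (Complex.conj_eq_iff_im.1 h)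
    have hM : ∀ m u v, H ((M' ^ m) u) v = H u ((M ^ m) v) :=
      fun m u v => adj_pow H N hN _ lam (by simp) m u v
    have hkey : ∀ m, H y ((M ^ m) w) = if m = K then 1 else 0 := by
      intro m
      split_ifs with h
      · rw [h, hwe]
      · by_cases h3 : m < K
        · exact hwj _ h3
        · rw [pow_apply_zero M (K + 1) _ w hw (by omega), map_zero]
    refine ⟨2 * (K + 1), lam, 1, fun j => if (j : ℕ) < K + 1 then (M ^ (K - (j : ℕ))) w
      else (M' ^ (2 * K + 1 - (j : ℕ))) y, by omega, Or.inr ⟨hlam, by simp, rfl⟩, ?_, ?_⟩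
    · intro j
      have hs := sum_helper (2 * (K + 1)) j j.2 (fun l => l + 1 ≠ 2 * (K + 1) / 2)
        (fun l => if l < 2 * (K + 1) / 2 then lam else starRingEnd ℂ lam)
        (fun j => if (j : ℕ) < K + 1 then (M ^ (K - (j : ℕ))) w
          else (M' ^ (2 * K + 1 - (j : ℕ))) y)
      simp only [jordanLike, if_neg hlam, Matrix.of_apply]
      rw [hs]
      have h2 : 2 * (K + 1) / 2 = K + 1 := by omega
      rw [h2]
      have := j.2
      by_cases hj : (j : ℕ) < K + 1
      · simp only [if_pos hj]
        rw [hNM lam, pow_comp_apply]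
        congr 1
        by_cases h0 : (j : ℕ) = 0
        · rw [if_pos h0]
          exact pow_apply_zero M (K + 1) _ w hw (by omega)
        · rw [if_neg h0, if_pos (by omega), if_pos (by omega)]
          congr 2; omega
      · simp only [if_neg hj]
        rw [hNM (starRingEnd ℂ lam), pow_comp_apply, if_neg (by omega)]
        congr 1
        by_cases h0 : (j : ℕ) = K + 1
        · rw [if_neg (by omega)]
          exact pow_apply_zero M' (K + 1) _ y hyK (by omega)
        · rw [if_pos (by omega), if_neg (by omega)]
          congr 2; omega
    · intro i j
      have h1 := i.2
      have h2 := j.2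
      simp only [sipC, Matrix.of_apply, one_mul]
      by_cases hi : (i : ℕ) < K + 1 <;> by_cases hj : (j : ℕ) < K + 1
      · rw [if_pos hi, if_pos hj, if_neg (by omega)]
        exact orth_gen H N hN lam lam hlc _ _ (hU _ _ _ hwU) (hU _ _ _ hwU)
      · rw [if_pos hi, if_neg hj, hH, hM, pow_comp_apply, hkey]
        split_ifs <;> first | omega | simp
      · rw [if_neg hi, if_pos hj, hM, pow_comp_apply, hkey]
        split_ifs <;> first | omega | simp
      · rw [if_neg hi, if_neg hj, if_neg (by omega)]
        exact orth_gen H N hN _ _ (by simpa using hlc.symm) _ _ (hU _ _ _ hy) (hU _ _ _ hy)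

/-- The abstract canonical form. -/
lemma abstract_form (d : ℕ) : ∀ (V : Type) [AddCommGroup V] [Module ℂ V] [FiniteDimensional ℂ V]
    (H : V →ₗ⋆[ℂ] V →ₗ[ℂ] ℂ) (N : Module.End ℂ V),
    (∀ x y, H y x = starRingEnd ℂ (H x y)) →
    (∀ x y, H (N x) y = H x (N y)) → (∀ y, (∀ x, H y x = 0) → y = 0) →
    Module.finrank ℂ V = d →
    ∃ (ι : Type) (_ : Fintype ι) (k : ι → ℕ) (lam ε : ι → ℂ) (b : (i : ι) → Fin (k i) → V),
      (∀ i, KBlock H N (k i) (lam i) (ε i) (b i)) ∧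
      (∀ i i', i ≠ i' → ∀ j l, H (b i j) (b i' l) = 0) ∧
      Submodule.span ℂ (Set.range fun p : Σ i, Fin (k i) => b p.1 p.2) = ⊤ := by
  induction d using Nat.strong_induction_on with
  | _ d ih =>
  intro V _ _ _ H N hH hN hnd hd
  rcases subsingleton_or_nontrivial V with hsub | hnt
  · exact ⟨Empty, inferInstance, fun i => i.elim, fun i => i.elim, fun i => i.elim,
      fun i => i.elim, fun i => i.elim, fun i => i.elim, Subsingleton.elim _ _⟩
  obtain ⟨K, lam, ε, b, hb⟩ := exists_block H hH N hN hnd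
  obtain ⟨hK, hle, hact, hgram⟩ := id hb
  have hεε : ε * ε = 1 := by
    rcases hle with ⟨_, h | h⟩ | ⟨_, _, h⟩ <;> simp [h]
  let W : Submodule ℂ V := ⨅ i, LinearMap.ker (H (b i))
  have hW : ∀ v, v ∈ W ↔ ∀ i, H (b i) v = 0 := by
    intro v; simp [W]
  have hgram' : ∀ i j, H (b i) (b j) = if j = i.rev then ε else 0 := by
    intro i j
    rw [hgram]
    simp only [sipC, Matrix.of_apply, Fin.ext_iff, Fin.val_rev]
    have := i.2
    have := j.2
    split_ifs <;> first | omega | simp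
  have hNW : ∀ v ∈ W, N v ∈ W := by
    intro v hv
    rw [hW] at hv ⊢
    intro i
    rw [← hN, hact]
    simp [hv]
  -- the projection
  have hproj : ∀ v : V, v - ∑ i, (ε * H (b i) v) • b i.rev ∈ W := by
    intro v
    rw [hW]
    intro i
    have : ∀ j : Fin K, (i.rev = j) ↔ (i = j.rev) := fun j => by
      rw [Fin.rev_eq_iff]
    simp only [map_sub, map_sum, map_smul, smul_eq_mul, hgram', Fin.rev_inj, mul_ite, mul_zero,
      Finset.sum_ite_eq', Finset.mem_univ, if_true]
    linear_combination (- H (b i) v) * hεε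
  have hlt : Module.finrank ℂ W < d := by
    rw [← hd]
    apply Submodule.finrank_lt
    intro htop
    have h1 : b ⟨0, hK⟩ ∈ W := htop ▸ Submodule.mem_top
    rw [hW] at h1
    have h2 := h1 (Fin.rev ⟨0, hK⟩)
    rw [hgram', if_pos (by simp)] at h2
    rw [h2] at hεε
    simp at hεε
  have hWb : ∀ v ∈ W, ∀ i, H v (b i) = 0 := by
    intro v hv i
    rw [hH, (hW v).1 hv, map_zero]
  obtain ⟨ι, hι, k, lam', ε', b', hb', horth, hspan⟩ := ih _ hlt W (H.domRestrict₁₂ W W)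
    (N.restrict hNW) (fun x y => hH _ _) (fun x y => hN _ _) (by
      intro y hy
      have : (y : V) = 0 := by
        apply hnd
        intro x
        have h1 := hy ⟨_, hproj x⟩
        rw [LinearMap.domRestrict₁₂_apply] at h1
        simp only [map_sub, map_sum, map_smul, hWb y y.2] at h1
        simpa using h1
      exact Subtype.ext this) rfl
  refine ⟨Option ι, inferInstance, fun o => o.elim K k, fun o => o.elim lam lam',
    fun o => o.elim ε ε', fun o => match o with
      | none => b
      | some i => fun j => (b' i j : V), ?_, ?_, ?_⟩
  · rintro (_ | i)
    · exact hb
    · obtain ⟨h1, h2, h3, h4⟩ := hb' i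
      refine ⟨h1, h2, fun j => ?_, fun j l => h4 j l⟩
      have := congrArg (Subtype.val) (h3 j)
      simp only [LinearMap.coe_restrict_apply, AddSubmonoidClass.coe_finsetSum,
        Submodule.coe_smul] at this
      exact this
  · rintro (_ | i) (_ | i') hne j l
    · exact absurd rfl hne
    · exact (hW _).1 (b' i' l).2 j
    · exact hWb _ (b' i j).2 l
    · exact horth i i' (fun h => hne (by rw [h])) j l
  · rw [eq_top_iff]
    intro v _
    set S : Submodule ℂ V := Submodule.span ℂ _ with hS
    have hbS : ∀ j, b j ∈ S := fun j => Submodule.subset_span ⟨⟨none, j⟩, rfl⟩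
    have hWS : W ≤ S := by
      have h1 : Submodule.map W.subtype ⊤ ≤ S := by
        rw [← hspan, Submodule.map_span, Submodule.span_le]
        rintro _ ⟨_, ⟨⟨i, j⟩, rfl⟩, rfl⟩
        exact Submodule.subset_span ⟨⟨some i, j⟩, rfl⟩
      simpa using h1
    have h2 := S.add_mem (hWS (hproj v))
      (S.sum_mem (fun i (_ : i ∈ Finset.univ) => S.smul_mem (ε * H (b i) v) (hbS i.rev)))
    rwa [sub_add_cancel] at h2

lemma lin_indep_of_blocks {V : Type} [AddCommGroup V] [Module ℂ V]
    (H : V →ₗ⋆[ℂ] V →ₗ[ℂ] ℂ) (N : Module.End ℂ V) {ι : Type} [Fintype ι]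
    (k : ι → ℕ) (lam ε : ι → ℂ) (b : (i : ι) → Fin (k i) → V)
    (hb : ∀ i, KBlock H N (k i) (lam i) (ε i) (b i))
    (ho : ∀ i i', i ≠ i' → ∀ j l, H (b i j) (b i' l) = 0) :
    LinearIndependent ℂ (fun p : Σ i, Fin (k i) => b p.1 p.2) := by
  classical
  rw [Fintype.linearIndependent_iff]
  rintro g hg ⟨i, j⟩
  obtain ⟨hK, hle, hact, hgram⟩ := hb i
  have hε : ε i ≠ 0 := by
    rcases hle with ⟨_, h | h⟩ | ⟨_, _, h⟩ <;> simp [h]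
  have h1 := congrArg (H (b i j.rev)) hg
  rw [map_sum, map_zero, Finset.sum_eq_single (⟨i, j⟩ : Σ i, Fin (k i))] at h1
  · rw [map_smul, hgram] at h1
    simp only [sipC, Matrix.of_apply, Fin.val_rev] at h1
    rw [if_pos (by omega)] at h1
    simpa [hε] using h1
  · rintro ⟨i', l⟩ _ hne
    rw [map_smul]
    by_cases hi : i = i'
    · subst hi
      rw [hgram]
      simp only [sipC, Matrix.of_apply, Fin.val_rev]
      rw [if_neg]
      · simp
      · intro h
        apply hne
        congr 1
        apply Fin.ext
        omega
    · simp [ho i i' hi]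
  · simp

/-- Sorting a finite type so that the elements satisfying a predicate come first. -/
lemma exists_sort {ι : Type} [Fintype ι] (P : ι → Prop) :
    ∃ (B A : ℕ) (_ : A ≤ B) (σ : Fin B ≃ ι), ∀ i : Fin B, (i : ℕ) < A ↔ P (σ i) := by
  classical
  let e1 := Fintype.equivFin {i // P i}
  let e2 := Fintype.equivFin {i // ¬ P i}
  refine ⟨Fintype.card {i // P i} + Fintype.card {i // ¬ P i}, Fintype.card {i // P i},
    Nat.le_add_right _ _, finSumFinEquiv.symm.trans
      ((Equiv.sumCongr e1.symm e2.symm).trans (Equiv.sumCompl P)), fun i => ?_⟩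
  refine Fin.addCases (fun i => ?_) (fun i => ?_) i
  · simp [(e1.symm i).2]
  · simp [(e2.symm i).2]

end KreinAux

/-- Canonical form of a ♭-Hermitian matrix in the Krein space `(ℂ^{2n}, J)`:
there is an invertible `Z` bringing `𝒩` into a direct sum of blocks
`𝐣_{kᵢ}(λᵢ)` while simultaneously `Z† J Z` becomes the direct sum of the
corresponding signed sip matrices `εᵢ 𝒮_{kᵢ}`, where the `λᵢ` are real for
`i ≤ A` (with signs `εᵢ = ±1`) and non-real with even `kᵢ` (and `εᵢ = 1`) for
`i > A`. -/
theorem krein_spectral_canonical_form (n : ℕ)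
    (𝒩 : Matrix (Fin n ⊕ Fin n) (Fin n ⊕ Fin n) ℂ) (h : flatAdj 𝒩 = 𝒩) :
    ∃ (B A : ℕ) (hAB : A ≤ B) (k : Fin B → ℕ) (lam : Fin B → ℂ) (ε : Fin B → ℂ)
      (Z : Matrix (Fin n ⊕ Fin n) (Fin n ⊕ Fin n) ℂ)
      (e : (Σ i : Fin B, Fin (k i)) ≃ (Fin n ⊕ Fin n)),
      (∀ i, 0 < k i) ∧ (∑ i, k i = 2 * n) ∧
      (∀ i : Fin B, (i : ℕ) < A → (lam i).im = 0 ∧ (ε i = 1 ∨ ε i = -1)) ∧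
      (∀ i : Fin B, A ≤ (i : ℕ) → (lam i).im ≠ 0 ∧ Even (k i) ∧ ε i = 1) ∧
      IsUnit Z ∧
      Z⁻¹ * 𝒩 * Z
        = Matrix.reindex e e (Matrix.blockDiagonal' fun i => jordanLike (k i) (lam i)) ∧
      Zᴴ * Jmat n * Z
        = Matrix.reindex e e (Matrix.blockDiagonal' fun i => ε i • sipC (k i)) := by
  classical
  have hJH : (Jmat n)ᴴ = Jmat n := by
    simp [Jmat, Matrix.fromBlocks_conjTranspose]
  have hJJ : Jmat n * Jmat n = 1 := by
    simp [Jmat, Matrix.fromBlocks_multiply]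
  have hNJ : 𝒩ᴴ * Jmat n = Jmat n * 𝒩 := by
    conv_rhs => rw [← h]
    rw [flatAdj, ← Matrix.mul_assoc, ← Matrix.mul_assoc, hJJ, Matrix.one_mul]
  let H : ((Fin n ⊕ Fin n) → ℂ) →ₗ⋆[ℂ] ((Fin n ⊕ Fin n) → ℂ) →ₗ[ℂ] ℂ :=
    LinearMap.mk₂'ₛₗ (starRingEnd ℂ) (RingHom.id ℂ) (fun x y => star x ⬝ᵥ (Jmat n *ᵥ y))
      (fun x y z => by simp [add_dotProduct])
      (fun c x y => by simp)
      (fun x y z => by simp [Matrix.mulVec_add])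
      (fun c x y => by simp [Matrix.mulVec_smul])
  have hHdef : ∀ x y, H x y = star x ⬝ᵥ (Jmat n *ᵥ y) := fun x y => rfl
  have hH : ∀ x y, H y x = starRingEnd ℂ (H x y) := by
    intro x y
    rw [hHdef, hHdef, starRingEnd_apply, star_dotProduct, star_mulVec, hJH,
      dotProduct_mulVec]
  have hN : ∀ x y, H ((Matrix.toLin' 𝒩) x) y = H x ((Matrix.toLin' 𝒩) y) := by
    intro x y
    rw [hHdef, hHdef, Matrix.toLin'_apply, Matrix.toLin'_apply, star_mulVec, ← dotProduct_mulVec,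
      mulVec_mulVec, mulVec_mulVec, hNJ]
  have hnd : ∀ y, (∀ x, H y x = 0) → y = 0 := by
    intro y hy
    have h1 := hy (Jmat n *ᵥ y)
    rw [hHdef, mulVec_mulVec, hJJ, one_mulVec] at h1
    open scoped ComplexOrder in
    exact dotProduct_star_self_eq_zero.1 h1
  obtain ⟨ι, hι, k, lam, ε, b, hb, ho, hspan⟩ :=
    abstract_form _ _ H (Matrix.toLin' 𝒩) hH hN hnd rfl
  obtain ⟨B, A, hAB, σ, hσ⟩ := exists_sort (fun i => (lam i).im = 0)
  have hli := lin_indep_of_blocks H _ k lam ε b hb ho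
  let bas := Module.Basis.mk hli hspan.ge
  have hcard : Fintype.card (Σ i : Fin B, Fin (k (σ i))) = Fintype.card (Fin n ⊕ Fin n) := by
    have h1 := Module.finrank_eq_card_basis bas
    rw [Module.finrank_fintype_fun_eq_card] at h1
    rw [h1]
    exact Fintype.card_congr (Equiv.sigmaCongrLeft (β := fun i => Fin (k i)) σ)
  let τ : (Σ i : Fin B, Fin (k (σ i))) ≃ (Σ i, Fin (k i)) :=
    Equiv.sigmaCongrLeft (β := fun i => Fin (k i)) σ
  let e : (Σ i : Fin B, Fin (k (σ i))) ≃ (Fin n ⊕ Fin n) := Fintype.equivOfCardEq hcard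
  let c : (Σ i : Fin B, Fin (k (σ i))) → ((Fin n ⊕ Fin n) → ℂ) := fun p => b (σ p.1) p.2
  let Z : Matrix (Fin n ⊕ Fin n) (Fin n ⊕ Fin n) ℂ := Matrix.of fun r s => c (e.symm s) r
  have hZe : ∀ r p, Z r (e p) = b (σ p.1) p.2 r := by
    intro r p
    change c (e.symm (e p)) r = _
    rw [Equiv.symm_apply_apply]
  have hZ : IsUnit Z := by
    rw [← Matrix.linearIndependent_cols_iff_isUnit]
    have h1 : LinearIndependent ℂ c := hli.comp τ τ.injective
    exact h1.comp e.symm e.symm.injective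
  have hdet : IsUnit Z.det := (Matrix.isUnit_iff_isUnit_det Z).1 hZ
  refine ⟨B, A, hAB, fun i => k (σ i), fun i => lam (σ i), fun i => ε (σ i), Z, e,
    fun i => (hb _).1, ?_, ?_, ?_, hZ, ?_, ?_⟩
  · have h1 := hcard
    simp only [Fintype.card_sigma, Fintype.card_fin, Fintype.card_sum] at h1
    rw [h1]; ring
  · intro i hi
    have h1 := (hσ i).1 hi
    rcases (hb (σ i)).2.1 with h2 | h2
    · exact h2
    · exact absurd h1 h2.1
  · intro i hi
    have h1 : ¬ (lam (σ i)).im = 0 := fun h => absurd ((hσ i).2 h) (by omega)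
    rcases (hb (σ i)).2.1 with h2 | h2
    · exact absurd h2.1 h1
    · exact h2
  · rw [Matrix.mul_assoc]
    have key : 𝒩 * Z = Z * Matrix.reindex e e
        (Matrix.blockDiagonal' fun i => jordanLike (k (σ i)) (lam (σ i))) := by
      ext r s
      obtain ⟨⟨i, j⟩, rfl⟩ := e.surjective s
      have h1 := congrFun ((hb (σ i)).2.2.1 j) r
      rw [Matrix.toLin'_apply] at h1
      have h2 : (𝒩 * Z) r (e ⟨i, j⟩) = (𝒩 *ᵥ b (σ i) j) r := by
        simp [Matrix.mul_apply, Matrix.mulVec, dotProduct, hZe]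
      rw [h2, h1, Matrix.mul_apply, ← e.sum_comp, Fintype.sum_sigma, Finset.sum_eq_single i]
      · simp [hZe, Finset.sum_apply, mul_comm]
      · intro i' _ hne
        apply Finset.sum_eq_zero
        intro l _
        simp [Matrix.blockDiagonal'_apply_ne _ _ _ hne]
      · simp
    rw [key, ← Matrix.mul_assoc, Matrix.nonsing_inv_mul _ hdet, Matrix.one_mul]
  · ext r s
    obtain ⟨⟨i, j⟩, rfl⟩ := e.surjective r
    obtain ⟨⟨i', l⟩, rfl⟩ := e.surjective s
    have h1 : (Zᴴ * Jmat n * Z) (e ⟨i, j⟩) (e ⟨i', l⟩) = H (b (σ i) j) (b (σ i') l) := by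
      rw [hHdef, Matrix.mul_assoc, Matrix.mul_apply]
      simp [dotProduct, Matrix.mulVec, Matrix.mul_apply, hZe]
    rw [h1]
    by_cases hi : i = i'
    · subst hi
      rw [(hb (σ i)).2.2.2]
      simp [Matrix.blockDiagonal'_apply_eq]
    · rw [ho _ _ (fun h => hi (σ.injective h))]
      simp [Matrix.blockDiagonal'_apply_ne _ _ _ hi]
end
end

section
/- Let N be a 2m×2n complex doubled-up matrix and 𝒩 = N^♭N. Then: (i) rank(N^♭) = rank(N); (ii) 2·rank(N) − 2m ≤ rank(𝒩) ≤ rank(N); (iii) if moreover m ≤ n and rank(N) = 2m, then rank(𝒩) = 2m and Ker(𝒩) = Ker(N), i.e., N is J-nondegenerate. -/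
open Matrix

noncomputable section

theorem Jmat_mul_self (k : ℕ) : Jmat k * Jmat k = 1 := by
  simp [Jmat, Matrix.fromBlocks_multiply]

theorem Jmat_det_isUnit (k : ℕ) : IsUnit (Jmat k).det := by
  have h := congrArg Matrix.det (Jmat_mul_self k)
  rw [Matrix.det_mul, Matrix.det_one] at h
  exact IsUnit.of_mul_eq_one _ h

open scoped ComplexOrder in
theorem rank_flatAdj {r s : ℕ} (X : Matrix (Fin r ⊕ Fin r) (Fin s ⊕ Fin s) ℂ) :
    (flatAdj X).rank = X.rank := by
  unfold flatAdj
  rw [Matrix.rank_mul_eq_left_of_isUnit_det _ _ (Jmat_det_isUnit r),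
    Matrix.rank_mul_eq_right_of_isUnit_det _ _ (Jmat_det_isUnit s), Matrix.rank_conjTranspose]

/-- Sylvester's rank inequality. -/
theorem sylvester_rank {a b c : Type} [Fintype a] [Fintype b] [Fintype c]
    (A : Matrix a b ℂ) (B : Matrix b c ℂ) :
    A.rank + B.rank ≤ (A * B).rank + Fintype.card b := by
  have hA := LinearMap.finrank_range_add_finrank_ker A.mulVecLin
  have hR := LinearMap.finrank_range_add_finrank_ker
    (A.mulVecLin.domRestrict (LinearMap.range B.mulVecLin))
  rw [Module.finrank_fintype_fun_eq_card] at hA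
  have h1 : LinearMap.range (A.mulVecLin.domRestrict (LinearMap.range B.mulVecLin))
      = LinearMap.range (A * B).mulVecLin := by
    rw [LinearMap.range_domRestrict, Matrix.mulVecLin_mul, LinearMap.range_comp]
  have h2 : Module.finrank ℂ
      (LinearMap.ker (A.mulVecLin.domRestrict (LinearMap.range B.mulVecLin)))
      ≤ Module.finrank ℂ (LinearMap.ker A.mulVecLin) := by
    refine LinearMap.finrank_le_finrank_of_injective
      (f := ((LinearMap.range B.mulVecLin).subtype.comp (Submodule.subtype _)).codRestrict _
        (fun x => x.2)) ?_
    intro x y h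
    have h' := congrArg (fun z : LinearMap.ker A.mulVecLin => (z : b → ℂ)) h
    exact Subtype.ext (Subtype.ext h')
  rw [h1] at hR
  unfold Matrix.rank
  omega

/-- Rank facts for doubled-up matrices: `rank(N^♭) = rank N`,
`2 rank N − 2m ≤ rank(N^♭N) ≤ rank N`, and if `m ≤ n` and `rank N = 2m`
then `rank(N^♭N) = 2m` and `Ker(N^♭N) = Ker N` (J-nondegeneracy). -/
theorem doubledUp_rank_nondegenerate (m n : ℕ)
    (N : Matrix (Fin m ⊕ Fin m) (Fin n ⊕ Fin n) ℂ) (hN : DoubledUp N) :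
    (flatAdj N).rank = N.rank ∧
    2 * N.rank - 2 * m ≤ (flatAdj N * N).rank ∧
    (flatAdj N * N).rank ≤ N.rank ∧
    (m ≤ n → N.rank = 2 * m →
      (flatAdj N * N).rank = 2 * m ∧
      ∀ v : Fin n ⊕ Fin n → ℂ, (flatAdj N * N).mulVec v = 0 ↔ N.mulVec v = 0) := by
  have h1 := rank_flatAdj N
  have h2 := sylvester_rank (flatAdj N) N
  have h3 := Matrix.rank_mul_le_right (flatAdj N) N
  have hc : Fintype.card (Fin m ⊕ Fin m) = 2 * m := by simp; omega
  refine ⟨h1, by omega, h3, fun _ hr => ⟨by omega, fun v => ⟨fun hv => ?_, fun hv => ?_⟩⟩⟩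
  · have hk := LinearMap.finrank_range_add_finrank_ker (flatAdj N).mulVecLin
    rw [Module.finrank_fintype_fun_eq_card] at hk
    have h0 : Module.finrank ℂ (LinearMap.ker (flatAdj N).mulVecLin) = 0 := by
      unfold Matrix.rank at *
      omega
    rw [Submodule.finrank_eq_zero, LinearMap.ker_eq_bot'] at h0
    refine h0 _ ?_
    rw [Matrix.mulVecLin_apply, Matrix.mulVec_mulVec]
    exact hv
  · rw [← Matrix.mulVec_mulVec, hv, Matrix.mulVec_zero]
end
end

section
/- Let P = [[P₁, P₂],[P₂^#, P₁^#]] be a 2m×2r complex doubled-up matrix satisfying P^♭P = 0 and PP^♭ = 0. Then: (i) P₁†P₁ = P₂⊤P₂^# and P₁P₁† = P₂P₂†; (ii) there exist an m×m unitary matrix U, an r×r unitary matrix Y, an m×r matrix H with nonnegative diagonal entries and zeros elsewhere, and an m×m diagonal matrix E with all diagonal entries equal to +1 or −1, such that P₁ = U·H·Y† and P₂ = U·E·H·Y⊤; consequently P = diag(U, U^#)·[[H, EH],[EH, H]]·diag(Y†, Y⊤). -/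
open Matrix

noncomputable section

/-- A real-linear singular value decomposition with complex-orthonormal singular vectors. -/
theorem real_svd_aux {E F : Type*} [NormedAddCommGroup E] [InnerProductSpace ℂ E]
    [FiniteDimensional ℂ E] [NormedAddCommGroup F] [InnerProductSpace ℂ F]
    (R : E → F) (R' : F → E)
    (hadd : ∀ x y, R (x + y) = R x + R y)
    (hsm : ∀ (c : ℝ) x, R ((c : ℂ) • x) = (c : ℂ) • R x)
    (hadd' : ∀ x y, R' (x + y) = R' x + R' y)
    (hsm' : ∀ (c : ℝ) x, R' ((c : ℂ) • x) = (c : ℂ) • R' x)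
    (hadj : ∀ x z, (inner ℂ (R x) z).re = (inner ℂ x (R' z)).re)
    (h1 : ∀ z, R (Complex.I • R' z) = 0)
    (h2 : ∀ x, R' (Complex.I • R x) = 0) :
    ∃ (ι : Type) (_ : Fintype ι) (y : ι → E) (u : ι → F) (σ : ι → ℝ),
      (∀ i, 0 ≤ σ i) ∧ Orthonormal ℂ y ∧ Orthonormal ℂ u ∧
      ∀ x, R x = ∑ i, ((σ i * (inner ℂ (y i) x).re : ℝ) : ℂ) • u i := by
  classical
  let _ : InnerProductSpace ℝ E := InnerProductSpace.complexToReal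
  have _ : FiniteDimensional ℝ E := FiniteDimensional.complexToReal E
  have hri : ∀ x y : E, inner ℝ x y = (inner ℂ x y).re := fun x y => rfl
  have hrs : ∀ (c : ℝ) (x : E), c • x = (c : ℂ) • x := fun c x => rfl
  let T : E →ₗ[ℝ] E :=
    { toFun := fun x => R' (R x)
      map_add' := fun x y => by rw [hadd, hadd']
      map_smul' := fun c x => by
        simp only [hrs, hsm, hsm', RingHom.id_apply] }
  have hadj2 : ∀ x z, (inner ℂ (R' z) x).re = (inner ℂ z (R x)).re := by
    intro x z
    rw [← inner_conj_symm, Complex.conj_re, ← hadj, ← inner_conj_symm, Complex.conj_re]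
  have hT : T.IsSymmetric := by
    intro x y
    rw [hri, hri]
    change (inner ℂ (R' (R x)) y).re = (inner ℂ x (R' (R y))).re
    rw [hadj2, hadj]
  let b := hT.eigenvectorBasis rfl
  let l := hT.eigenvalues rfl
  have hb : ∀ j, R' (R (b j)) = (l j : ℂ) • b j := fun j => hT.apply_eigenvectorBasis rfl j
  have hbo : ∀ i j, (inner ℂ (b i) (b j)).re = if i = j then 1 else 0 := fun i j => by
    rw [← hri]; exact orthonormal_iff_ite.1 b.orthonormal i j
  have hRR : ∀ i j, (inner ℂ (R (b i)) (R (b j))).re = if i = j then l j else 0 := fun i j => by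
    rw [hadj, hb, inner_smul_right, Complex.re_ofReal_mul, hbo]; split_ifs <;> simp
  have hl0 : ∀ j, 0 ≤ l j := fun j => by
    have := hRR j j
    rw [if_pos rfl] at this
    rw [← this]; exact inner_self_nonneg (𝕜 := ℂ)
  have hz : ∀ j, l j = 0 → R (b j) = 0 := fun j h => by
    have := hRR j j
    rw [if_pos rfl, h] at this
    exact (re_inner_self_nonpos (𝕜 := ℂ)).1 this.le
  have him : ∀ {G : Type _} [NormedAddCommGroup G] [InnerProductSpace ℂ G] (x y : G),
      (inner ℂ x (Complex.I • y)).re = -(inner ℂ x y).im := fun x y => by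
    simp
  have him' : ∀ x y : F,
      (inner ℂ x (Complex.I • y)).re = -(inner ℂ x y).im := fun x y => by
    simp
  have hRim : ∀ i j, (inner ℂ (R (b i)) (R (b j))).im = 0 := fun i j => by
    have := him' (R (b i)) (R (b j))
    rw [hadj, h2] at this
    simpa using this.symm
  have hbim : ∀ i j, l i ≠ 0 → l j ≠ 0 → (inner ℂ (b i) (b j)).im = 0 := fun i j hi hj => by
    have h := him (R' (R (b i))) (R' (R (b j)))
    rw [hadj2, h1, hb, hb, inner_smul_left, inner_smul_right, Complex.conj_ofReal,
      Complex.im_ofReal_mul, Complex.im_ofReal_mul] at h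
    simpa [hi, hj] using h
  have hsum : ∀ (s : Finset (Fin (Module.finrank ℝ E))) (c : _ → ℝ),
      R (∑ i ∈ s, (c i : ℂ) • b i) = ∑ i ∈ s, (c i : ℂ) • R (b i) := by
    intro s c
    induction s using Finset.induction_on with
    | empty => simpa using hsm 0 0
    | insert a s ha ih => rw [Finset.sum_insert ha, Finset.sum_insert ha, hadd, hsm, ih]
  refine ⟨{j // l j ≠ 0}, inferInstance, fun j => b j,
    fun j => (((√(l j))⁻¹ : ℝ) : ℂ) • R (b j), fun j => √(l j),
    fun j => Real.sqrt_nonneg _, ?_, ?_, ?_⟩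
  · rw [orthonormal_iff_ite]
    rintro ⟨i, hi⟩ ⟨j, hj⟩
    apply Complex.ext
    · rw [hbo]; simp only [Subtype.mk.injEq]; split_ifs <;> simp
    · rw [hbim i j hi hj]; split_ifs <;> simp
  · rw [orthonormal_iff_ite]
    rintro ⟨i, hi⟩ ⟨j, hj⟩
    rw [inner_smul_left, inner_smul_right, Complex.conj_ofReal]
    have hp : 0 < l j := lt_of_le_of_ne (hl0 j) (Ne.symm hj)
    apply Complex.ext
    · rw [Complex.re_ofReal_mul, Complex.re_ofReal_mul, hRR]
      simp only [Subtype.mk.injEq]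
      split_ifs with h
      · subst h
        have := Real.mul_self_sqrt hp.le
        have h0 : √(l i) ≠ 0 := (Real.sqrt_pos.2 hp).ne'
        simp only [Complex.one_re]
        field_simp
        nlinarith
      · simp
    · rw [Complex.im_ofReal_mul, Complex.im_ofReal_mul, hRim]; split_ifs <;> simp
  · intro x
    have hx : x = ∑ i, (((inner ℂ (b i) x).re : ℝ) : ℂ) • b i := (b.sum_repr' x).symm
    conv_lhs => rw [hx, hsum]
    rw [← Finset.sum_subset (Finset.subset_univ (Finset.univ.filter (fun j => l j ≠ 0)))]
    · rw [← Finset.sum_subtype_eq_sum_filter]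
      rw [show (Finset.univ.subtype (fun j => l j ≠ 0)) = Finset.univ by ext; simp]
      refine Finset.sum_congr rfl ?_
      rintro ⟨j, hj⟩ -
      have hp : 0 < l j := lt_of_le_of_ne (hl0 j) (Ne.symm hj)
      have h0 : √(l j) ≠ 0 := (Real.sqrt_pos.2 hp).ne'
      rw [smul_smul, ← Complex.ofReal_mul]
      congr 2
      field_simp
    · intro j _ hj
      have : l j = 0 := by simpa using hj
      rw [hz j this, smul_zero]

/-- Extend an orthonormal family along an injection and produce a unitary matrix. -/
theorem exists_unitary_extend {ι : Type} [Fintype ι] {n : ℕ}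
    (y : ι → EuclideanSpace ℂ (Fin n)) (hy : Orthonormal ℂ y) (f : ι → Fin n)
    (hf : Function.Injective f) :
    ∃ Y ∈ Matrix.unitaryGroup (Fin n) ℂ, ∀ i a, Y a (f i) = y i a := by
  classical
  obtain ⟨b, hb⟩ := Orthonormal.exists_orthonormalBasis_extension_of_card_eq (𝕜 := ℂ)
    (E := EuclideanSpace ℂ (Fin n)) (ι := Fin n) (by simp)
    (v := Function.extend f y 0) (s := Set.range f) (by
      rw [orthonormal_iff_ite] at hy ⊢
      rintro ⟨_, i, rfl⟩ ⟨_, j, rfl⟩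
      simp only [Set.domRestrict_apply, hf.extend_apply, hy]
      by_cases h : i = j
      · subst h; simp
      · simp [h, Subtype.ext_iff, hf.eq_iff])
  refine ⟨Matrix.of fun a j => b j a, ?_, ?_⟩
  · rw [Matrix.mem_unitaryGroup_iff']
    ext i j
    have := orthonormal_iff_ite.1 b.orthonormal i j
    rw [PiLp.inner_apply] at this
    simp only [Matrix.mul_apply, Matrix.star_apply, Matrix.of_apply, Matrix.one_apply]
    rw [← this]
    refine Finset.sum_congr rfl fun k _ => ?_
    simp [mul_comm]
  · intro i a
    simp [hb (f i) ⟨i, rfl⟩, hf.extend_apply]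

theorem star_mulVec_conj {m r : ℕ} (M : Matrix (Fin m) (Fin r) ℂ) (v : Fin r → ℂ) :
    star (M *ᵥ v) = M.map (starRingEnd ℂ) *ᵥ star v := by
  ext i
  simp [Matrix.mulVec, dotProduct]

theorem adj_identity {m r : ℕ} (A B : Matrix (Fin m) (Fin r) ℂ) (x : Fin r → ℂ) (z : Fin m → ℂ) :
    (z ⬝ᵥ star (A *ᵥ x + B *ᵥ star x)).re = ((Aᴴ *ᵥ z + Bᵀ *ᵥ star z) ⬝ᵥ star x).re := by
  have e1 : z ⬝ᵥ star (A *ᵥ x) = (Aᴴ *ᵥ z) ⬝ᵥ star x := by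
    rw [Matrix.star_mulVec, dotProduct_comm, ← Matrix.dotProduct_mulVec, dotProduct_comm]
  have e2 : z ⬝ᵥ star (B *ᵥ star x) = star ((Bᵀ *ᵥ star z) ⬝ᵥ star x) := by
    rw [Matrix.mulVec_transpose, ← Matrix.dotProduct_mulVec]
    simp [dotProduct]
  rw [star_add, dotProduct_add, add_dotProduct, e1, e2]
  simp

theorem isotropy_identity {m r : ℕ} (A B : Matrix (Fin m) (Fin r) ℂ) (z : Fin m → ℂ)
    (h1 : A * Aᴴ = B * Bᴴ) (h2 : A * Bᵀ = B * Aᵀ) :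
    A *ᵥ (Complex.I • (Aᴴ *ᵥ z + Bᵀ *ᵥ star z))
      + B *ᵥ star (Complex.I • (Aᴴ *ᵥ z + Bᵀ *ᵥ star z)) = 0 := by
  have e1 : Aᴴ.map (starRingEnd ℂ) = Aᵀ := by ext i j; simp
  have e2 : Bᵀ.map (starRingEnd ℂ) = Bᴴ := by ext i j; simp
  rw [star_smul, star_add, star_mulVec_conj, star_mulVec_conj, e1, e2, star_star,
    Matrix.mulVec_smul, Matrix.mulVec_smul, Matrix.mulVec_add, Matrix.mulVec_add]
  simp only [Matrix.mulVec_mulVec, h1, h2, Complex.star_def, Complex.conj_I, neg_smul]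
  rw [add_comm ((B * Bᴴ) *ᵥ z)]
  simp

theorem doubled_core {m r : ℕ} (A B : Matrix (Fin m) (Fin r) ℂ)
    (h1 : A * Aᴴ = B * Bᴴ) (h2 : A * Bᵀ = B * Aᵀ)
    (h3 : Aᴴ * A = Bᵀ * Bᵀᴴ) (h4 : Aᴴ * B = Bᵀ * Aᴴᵀ) :
    ∃ (ι : Type) (_ : Fintype ι) (y : ι → EuclideanSpace ℂ (Fin r))
      (u : ι → EuclideanSpace ℂ (Fin m)) (σ : ι → ℝ),
      (∀ i, 0 ≤ σ i) ∧ Orthonormal ℂ y ∧ Orthonormal ℂ u ∧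
      (∀ a c, A a c = ∑ i, (σ i : ℂ) * u i a * star (y i c)) ∧
      (∀ a c, B a c = ∑ i, (σ i : ℂ) * u i a * y i c) := by
  obtain ⟨ι, hι, y, u, σ, hσ, hy, hu, hR⟩ := real_svd_aux
    (E := EuclideanSpace ℂ (Fin r)) (F := EuclideanSpace ℂ (Fin m))
    (fun x => WithLp.toLp 2 (A *ᵥ x.ofLp + B *ᵥ star x.ofLp))
    (fun z => WithLp.toLp 2 (Aᴴ *ᵥ z.ofLp + Bᵀ *ᵥ star z.ofLp))
    (fun x y => by
      apply WithLp.ofLp_injective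
      simp only [WithLp.ofLp_add, star_add, Matrix.mulVec_add]; abel)
    (fun c x => by
      apply WithLp.ofLp_injective
      simp only [WithLp.ofLp_smul, star_smul, Matrix.mulVec_smul, smul_add, Complex.star_def,
        Complex.conj_ofReal])
    (fun x y => by
      apply WithLp.ofLp_injective
      simp only [WithLp.ofLp_add, star_add, Matrix.mulVec_add]; abel)
    (fun c x => by
      apply WithLp.ofLp_injective
      simp only [WithLp.ofLp_smul, star_smul, Matrix.mulVec_smul, smul_add, Complex.star_def,
        Complex.conj_ofReal])
    (fun x z => by
      rw [EuclideanSpace.inner_eq_star_dotProduct, EuclideanSpace.inner_eq_star_dotProduct]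
      exact adj_identity A B x.ofLp z.ofLp)
    (fun z => by
      have := isotropy_identity A B z.ofLp h1 h2
      simp only [WithLp.ofLp_smul]
      rw [this, WithLp.toLp_zero])
    (fun x => by
      have := isotropy_identity Aᴴ Bᵀ x.ofLp (by simpa using h3) (by simpa using h4)
      simp only [conjTranspose_conjTranspose, transpose_transpose] at this
      simp only [WithLp.ofLp_smul]
      rw [this, WithLp.toLp_zero])
  have k1 : ∀ a c, A a c + B a c = ∑ i, ((σ i * (y i c).re : ℝ) : ℂ) * u i a := by
    intro a c
    have := congrArg (fun v : EuclideanSpace ℂ (Fin m) => v a) (hR (EuclideanSpace.single c 1))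
    simpa [Matrix.mulVec, dotProduct, Pi.single_apply, EuclideanSpace.inner_single_right] using this
  have k2 : ∀ a c, Complex.I * A a c - Complex.I * B a c
      = ∑ i, ((σ i * (y i c).im : ℝ) : ℂ) * u i a := by
    intro a c
    have := congrArg (fun v : EuclideanSpace ℂ (Fin m) => v a)
      (hR (EuclideanSpace.single c Complex.I))
    simpa [Matrix.mulVec, dotProduct, Pi.single_apply, EuclideanSpace.inner_single_right,
      mul_comm, sub_eq_add_neg, apply_ite] using this
  refine ⟨ι, hι, y, u, fun i => σ i / 2, fun i => by have := hσ i; positivity, hy, hu, ?_, ?_⟩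
  · intro a c
    have e : A a c = ((A a c + B a c) - Complex.I * (Complex.I * A a c - Complex.I * B a c)) / 2 := by
      linear_combination ((A a c) - B a c) / 2 * Complex.I_mul_I
    rw [e, k1, k2, Finset.mul_sum, ← Finset.sum_sub_distrib, Finset.sum_div]
    refine Finset.sum_congr rfl fun i _ => ?_
    have : star (y i c) = (y i c).re - (y i c).im * Complex.I := by
      apply Complex.ext <;> simp
    rw [this]
    push_cast
    ring
  · intro a c
    have e : B a c = ((A a c + B a c) + Complex.I * (Complex.I * A a c - Complex.I * B a c)) / 2 := by
      linear_combination ((A a c) - B a c) / 2 * (-Complex.I_mul_I)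
    rw [e, k1, k2, Finset.mul_sum, ← Finset.sum_add_distrib, Finset.sum_div]
    refine Finset.sum_congr rfl fun i _ => ?_
    conv_rhs => rw [← Complex.re_add_im (y i c)]
    push_cast
    ring

theorem doubled_svd {m r : ℕ} (A B : Matrix (Fin m) (Fin r) ℂ)
    (h1 : A * Aᴴ = B * Bᴴ) (h2 : A * Bᵀ = B * Aᵀ)
    (h3 : Aᴴ * A = Bᵀ * Bᵀᴴ) (h4 : Aᴴ * B = Bᵀ * Aᴴᵀ) :
    ∃ (U : Matrix (Fin m) (Fin m) ℂ) (Y : Matrix (Fin r) (Fin r) ℂ)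
      (H : Matrix (Fin m) (Fin r) ℂ),
      U ∈ Matrix.unitaryGroup (Fin m) ℂ ∧ Y ∈ Matrix.unitaryGroup (Fin r) ℂ ∧
      (∀ (i : Fin m) (j : Fin r), (i : ℕ) ≠ (j : ℕ) → H i j = 0) ∧
      (∀ (i : Fin m) (j : Fin r), ∃ t : ℝ, 0 ≤ t ∧ H i j = (t : ℂ)) ∧
      A = U * H * Yᴴ ∧ B = U * H * Yᵀ := by
  classical
  obtain ⟨ι, hι, y, u, σ, hσ, hy, hu, hA, hB⟩ := doubled_core A B h1 h2 h3 h4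
  have hr : Fintype.card ι ≤ r := by
    simpa using hy.linearIndependent.fintype_card_le_finrank
  have hm : Fintype.card ι ≤ m := by
    simpa using hu.linearIndependent.fintype_card_le_finrank
  let e := Fintype.equivFin ι
  let f : ι → Fin r := fun i => Fin.castLE hr (e i)
  let g : ι → Fin m := fun i => Fin.castLE hm (e i)
  obtain ⟨Y, hY, hYf⟩ := exists_unitary_extend y hy f
    ((Fin.castLE_injective hr).comp e.injective)
  obtain ⟨U, hU, hUg⟩ := exists_unitary_extend u hu g
    ((Fin.castLE_injective hm).comp e.injective)
  let H : Matrix (Fin m) (Fin r) ℂ := fun a b => ∑ i, if a = g i ∧ b = f i then (σ i : ℂ) else 0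
  have key : ∀ (Z : Matrix (Fin r) (Fin r) ℂ) a c,
      (U * H * Z) a c = ∑ i, (σ i : ℂ) * u i a * Z (f i) c := by
    intro Z a c
    have hUH : ∀ b, (U * H) a b = ∑ i, if b = f i then (σ i : ℂ) * u i a else 0 := by
      intro b
      rw [Matrix.mul_apply]
      simp only [H, Finset.mul_sum]
      rw [Finset.sum_comm]
      refine Finset.sum_congr rfl fun i _ => ?_
      by_cases hb : b = f i
      · simp [hb, hUg, mul_comm]
      · simp [hb]
    rw [Matrix.mul_apply]
    simp only [hUH, Finset.sum_mul]
    rw [Finset.sum_comm]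
    refine Finset.sum_congr rfl fun i _ => ?_
    simp [ite_mul]
  refine ⟨U, Y, H, hU, hY, ?_, ?_, ?_, ?_⟩
  · intro a b hab
    refine Finset.sum_eq_zero fun i _ => if_neg ?_
    rintro ⟨rfl, rfl⟩
    exact hab rfl
  · intro a b
    refine ⟨∑ i, if a = g i ∧ b = f i then σ i else 0,
      Finset.sum_nonneg fun i _ => ?_, ?_⟩
    · split_ifs
      exacts [hσ i, le_rfl]
    · simp only [H]
      push_cast
      refine Finset.sum_congr rfl fun i _ => ?_
      split_ifs <;> simp
  · ext a c
    rw [key, hA]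
    simp [hYf]
  · ext a c
    rw [key, hB]
    simp [hYf]

/-- Structure of doubled-up matrices `P` with `P^♭P = 0` and `PP^♭ = 0`:
(i) `P₁†P₁ = P₂ᵀP₂^#` and `P₁P₁† = P₂P₂†`;
(ii) `P₁ = U H Y†` and `P₂ = U E H Yᵀ` for unitary `U`, `Y`, a "diagonal"
`H ≥ 0` and a sign matrix `E`, so that
`P = diag(U, U^#)·[[H, EH],[EH, H]]·diag(Y†, Yᵀ)`. -/
theorem degenerate_doubledUp_structure (m r : ℕ)
    (P₁ P₂ : Matrix (Fin m) (Fin r) ℂ)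
    (P : Matrix (Fin m ⊕ Fin m) (Fin r ⊕ Fin r) ℂ)
    (hP : P = Matrix.fromBlocks P₁ P₂ (P₂.map (starRingEnd ℂ)) (P₁.map (starRingEnd ℂ)))
    (h1 : flatAdj P * P = 0) (h2 : P * flatAdj P = 0) :
    (P₁ᴴ * P₁ = P₂ᵀ * P₂.map (starRingEnd ℂ) ∧ P₁ * P₁ᴴ = P₂ * P₂ᴴ) ∧
    ∃ (U : Matrix (Fin m) (Fin m) ℂ) (Y : Matrix (Fin r) (Fin r) ℂ)
      (H : Matrix (Fin m) (Fin r) ℂ) (ε : Fin m → ℂ),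
      U ∈ Matrix.unitaryGroup (Fin m) ℂ ∧ Y ∈ Matrix.unitaryGroup (Fin r) ℂ ∧
      (∀ (i : Fin m) (j : Fin r), (i : ℕ) ≠ (j : ℕ) → H i j = 0) ∧
      (∀ (i : Fin m) (j : Fin r), (i : ℕ) = (j : ℕ) → ∃ t : ℝ, 0 ≤ t ∧ H i j = (t : ℂ)) ∧
      (∀ i, ε i = 1 ∨ ε i = -1) ∧
      P₁ = U * H * Yᴴ ∧
      P₂ = U * Matrix.diagonal ε * H * Yᵀ ∧
      P = Matrix.fromBlocks U 0 0 (U.map (starRingEnd ℂ))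
          * Matrix.fromBlocks H (Matrix.diagonal ε * H) (Matrix.diagonal ε * H) H
          * Matrix.fromBlocks Yᴴ 0 0 Yᵀ := by
  have J2 : ∀ k, Jmat k * Jmat k = 1 := fun k => by
    simp [Jmat, Matrix.fromBlocks_multiply, Matrix.fromBlocks_one]
  have h1' : Pᴴ * Jmat m * P = 0 := by
    have := congrArg (fun M => Jmat r * M) h1
    simpa [flatAdj, ← Matrix.mul_assoc, J2] using this
  have h2' : P * Jmat r * Pᴴ = 0 := by
    have := congrArg (fun M => M * Jmat m) h2
    simpa [flatAdj, Matrix.mul_assoc, J2] using this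
  have t1 : ∀ M : Matrix (Fin m) (Fin r) ℂ, (M.map (starRingEnd ℂ))ᴴ = Mᵀ := fun M => by
    ext i j; simp
  have t2 : ∀ M : Matrix (Fin m) (Fin r) ℂ, Mᵀᴴ = M.map (starRingEnd ℂ) := fun M => by
    ext i j; simp
  have t3 : ∀ M : Matrix (Fin m) (Fin r) ℂ, Mᴴᵀ = M.map (starRingEnd ℂ) := fun M => by
    ext i j; simp
  rw [hP, Jmat, Matrix.fromBlocks_conjTranspose, Matrix.fromBlocks_multiply,
    Matrix.fromBlocks_multiply, ← Matrix.fromBlocks_zero, Matrix.fromBlocks_inj] at h1' h2'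
  simp only [t1, Matrix.mul_one, Matrix.mul_zero, add_zero, zero_add, Matrix.mul_neg,
    Matrix.neg_mul] at h1' h2'
  have a1 : P₁ * P₁ᴴ = P₂ * P₂ᴴ := by
    have := h2'.1; rwa [← sub_eq_add_neg, sub_eq_zero] at this
  have a2 : P₁ * P₂ᵀ = P₂ * P₁ᵀ := by
    have := h2'.2.1; rwa [← sub_eq_add_neg, sub_eq_zero] at this
  have a3 : P₁ᴴ * P₁ = P₂ᵀ * P₂.map (starRingEnd ℂ) := by
    have := h1'.1; rwa [← sub_eq_add_neg, sub_eq_zero] at this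
  have a4 : P₁ᴴ * P₂ = P₂ᵀ * P₁.map (starRingEnd ℂ) := by
    have := h1'.2.1; rwa [← sub_eq_add_neg, sub_eq_zero] at this
  refine ⟨⟨a3, a1⟩, ?_⟩
  obtain ⟨U, Y, H, hU, hY, hH0, hH, hA, hB⟩ := doubled_svd P₁ P₂ a1 a2
    (by rw [t2]; exact a3) (by rw [t3]; exact a4)
  have hHr : H.map (starRingEnd ℂ) = H := by
    ext i j
    obtain ⟨t, -, ht⟩ := hH i j
    simp [ht]
  refine ⟨U, Y, H, fun _ => 1, hU, hY, hH0, fun i j _ => hH i j, fun _ => Or.inl rfl, hA, ?_, ?_⟩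
  · rw [Matrix.diagonal_one, Matrix.mul_one]; exact hB
  · rw [hP, Matrix.diagonal_one, Matrix.one_mul, Matrix.fromBlocks_multiply,
      Matrix.fromBlocks_multiply, Matrix.fromBlocks_inj]
    have c1 : Yᴴ.map (starRingEnd ℂ) = Yᵀ := by ext i j; simp
    have c2 : Yᵀ.map (starRingEnd ℂ) = Yᴴ := by ext i j; simp
    have q1 : P₁.map (starRingEnd ℂ) = U.map (starRingEnd ℂ) * H * Yᵀ := by
      rw [hA, Matrix.map_mul, Matrix.map_mul, hHr, c1]
    have q2 : P₂.map (starRingEnd ℂ) = U.map (starRingEnd ℂ) * H * Yᴴ := by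
      rw [hB, Matrix.map_mul, Matrix.map_mul, hHr, c2]
    refine ⟨?_, ?_, ?_, ?_⟩
    · simpa using hA
    · simpa using hB
    · simpa using q2
    · simpa using q1
end
end
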